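/- If a germ Ω of a 2-form of type 3 is written in the normal form Ω = exp(f)·( exp((1+x¹)x³) dx¹∧dx² + dx³∧dx⁴ ) with f(0)=0, and F = exp(−f) (so F(0)=1), then ω_Ω = df + (1+x¹)dx³ and φ_Ω = −(∂F/∂x⁴) dx¹ + exp(−(1+x¹)x³)·(∂F/∂x²) dx³. -/

import Mathlib

/-!  Coordinate formalization of differential forms in four variables,
     following "The equivalence problem of differential 2-forms in 4 variables". -/

open Real Filter

/-- Points of `ℝ⁴`; the coordinates `x¹, x², x³, x⁴` of the paper are `x 0, x 1, x 2, x 3`. -/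
abbrev Pt := Fin 4 → ℝ

/-- Partial derivative `∂f/∂xⁱ`. -/
noncomputable def pd (i : Fin 4) (f : Pt → ℝ) (x : Pt) : ℝ :=
  fderiv ℝ f x (Pi.single i 1)

/-- Second partial derivative `∂²f/∂xⁱ∂xʲ`. -/
noncomputable def pd2 (i j : Fin 4) (f : Pt → ℝ) (x : Pt) : ℝ :=
  pd i (fun y => pd j f y) x

/-- Differential forms of degree 0,1,2,3,4 on `ℝ⁴`, given by their (skew-symmetric)
    coordinate components, and vector fields. -/
abbrev Form0 := Pt → ℝ
abbrev Form1 := Pt → Fin 4 → ℝ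
abbrev Form2 := Pt → Fin 4 → Fin 4 → ℝ
abbrev Form3 := Pt → Fin 4 → Fin 4 → Fin 4 → ℝ
abbrev Form4 := Pt → Fin 4 → Fin 4 → Fin 4 → Fin 4 → ℝ
abbrev Vec := Pt → Fin 4 → ℝ

/-- A 2-form has skew-symmetric components. -/
def Alt2 (B : Form2) : Prop := ∀ x i j, B x i j = - B x j i

/-- Exterior derivative of a function. -/
noncomputable def d0 (f : Form0) : Form1 := fun x i => pd i f x

/-- Exterior derivative of a 1-form. -/
noncomputable def d1 (ω : Form1) : Form2 := fun x i j =>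
  pd i (fun y => ω y j) x - pd j (fun y => ω y i) x

/-- Exterior derivative of a 2-form. -/
noncomputable def d2 (B : Form2) : Form3 := fun x i j k =>
  pd i (fun y => B y j k) x - pd j (fun y => B y i k) x + pd k (fun y => B y i j) x

/-- Wedge product of two 1-forms. -/
def w11 (ω η : Form1) : Form2 := fun x i j => ω x i * η x j - ω x j * η x i

/-- Wedge product of a 1-form and a 2-form. -/
def w12 (ω : Form1) (B : Form2) : Form3 := fun x i j k =>
  ω x i * B x j k - ω x j * B x i k + ω x k * B x i j

/-- Wedge product of a 1-form and a 3-form. -/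
def w13 (ω : Form1) (C : Form3) : Form4 := fun x i j k l =>
  ω x i * C x j k l - ω x j * C x i k l + ω x k * C x i j l - ω x l * C x i j k

/-- Wedge product of two 2-forms. -/
def w22 (A B : Form2) : Form4 := fun x i j k l =>
  A x i j * B x k l - A x i k * B x j l + A x i l * B x j k
    + A x j k * B x i l - A x j l * B x i k + A x k l * B x i j

/-- A 2-form is of rank 4 when `Ω ∧ Ω` vanishes nowhere. -/
def Rank4 (B : Form2) : Prop := ∀ x, w22 B B x ≠ 0

/-- Interior products `i_X`. -/
def i1 (X : Vec) (ω : Form1) : Form0 := fun x => ∑ i, X x i * ω x i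
def i2 (X : Vec) (B : Form2) : Form1 := fun x j => ∑ i, X x i * B x i j
def i3 (X : Vec) (C : Form3) : Form2 := fun x j k => ∑ i, X x i * C x i j k
def i4 (X : Vec) (D : Form4) : Form3 := fun x j k l => ∑ i, X x i * D x i j k l

/-- Evaluation `B(X,Y)` of a 2-form on two vector fields. -/
def ev2 (B : Form2) (X Y : Vec) : Form0 := fun x => ∑ i, ∑ j, X x i * Y x j * B x i j

/-- Evaluation `D(X,Y,Z,W)` of a 4-form on four vector fields. -/
def ev4 (D : Form4) (X Y Z W : Vec) : Form0 := fun x =>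
  ∑ i, ∑ j, ∑ k, ∑ l, X x i * Y x j * Z x k * W x l * D x i j k l

/-- Lie derivative of a 1-form (Cartan's magic formula). -/
noncomputable def lie1 (X : Vec) (ω : Form1) : Form1 := fun x i =>
  d0 (i1 X ω) x i + i2 X (d1 ω) x i

/-- Lie derivative of a 2-form (Cartan's magic formula). -/
noncomputable def lie2 (X : Vec) (B : Form2) : Form2 := fun x i j =>
  d1 (i2 X B) x i j + i3 X (d2 B) x i j

/-- Lie bracket of two vector fields. -/
noncomputable def bracket (X Y : Vec) : Vec := fun x i =>
  ∑ j, (X x j * pd j (fun y => Y y i) x - Y x j * pd j (fun y => X y i) x)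

/-- Derivative `X(f)` of a function along a vector field. -/
noncomputable def dirDeriv (X : Vec) (f : Form0) : Form0 := fun x => ∑ j, X x j * pd j f x

/-- Pullback of a 1-form under a smooth map. -/
noncomputable def pull1 (φ : Pt → Pt) (ω : Form1) : Form1 := fun x i =>
  ∑ a, ω (φ x) a * pd i (fun y => φ y a) x

/-- Pullback of a 2-form under a smooth map. -/
noncomputable def pull2 (φ : Pt → Pt) (B : Form2) : Form2 := fun x i j =>
  ∑ a, ∑ b, B (φ x) a b * pd i (fun y => φ y a) x * pd j (fun y => φ y b) x

/-- A pair of mutually inverse smooth maps: a diffeomorphism of `ℝ⁴` (with inverse). -/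
def IsDiffeo (φ ψ : Pt → Pt) : Prop :=
  ContDiff ℝ (⊤ : ℕ∞) φ ∧ ContDiff ℝ (⊤ : ℕ∞) ψ ∧ (∀ x, ψ (φ x) = x) ∧ (∀ x, φ (ψ x) = x)

/-- The covector with components `c` as a linear functional on the tangent space `ℝ⁴`. -/
noncomputable def covec (c : Fin 4 → ℝ) : Pt →ₗ[ℝ] ℝ :=
  ∑ i, c i • (LinearMap.proj i : Pt →ₗ[ℝ] ℝ)

/-- The class of a 1-form `ω` at `x`: the codimension of the space of tangent vectors `v`
    with `i_v ω = 0` and `i_v (dω) = 0`. -/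
noncomputable def classAt (ω : Form1) (x : Pt) : ℕ :=
  4 - Module.finrank ℝ
    ↥(LinearMap.ker (covec (ω x)) ⊓ ⨅ j, LinearMap.ker (covec (fun i => d1 ω x i j)))

/-- Components of the constant 2-form `dxᵃ ∧ dxᵇ`. -/
def dxw (a b : Fin 4) : Fin 4 → Fin 4 → ℝ := fun i j =>
  (if i = a ∧ j = b then (1:ℝ) else 0) - (if i = b ∧ j = a then (1:ℝ) else 0)

/-- A germ of 2-form (with associated 1-form `ω = ω_Ω`) is of type `t` at `x₀`:
    `ω` is nonsingular at `x₀` and of constant class `t` near `x₀`. -/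
def IsTypeAt (ω : Form1) (t : ℕ) (x₀ : Pt) : Prop :=
  ω x₀ ≠ 0 ∧ ∀ᶠ x in nhds x₀, classAt ω x = t

theorem pd_eq_of_hasFDerivAt {g : Pt → ℝ} {g' : Pt →L[ℝ] ℝ} {x : Pt} (i : Fin 4)
    (h : HasFDerivAt g g' x) : pd i g x = g' (Pi.single i 1) := by
  unfold pd
  rw [h.fderiv]

theorem pd_exp {g : Pt → ℝ} {x : Pt} (i : Fin 4) (h : DifferentiableAt ℝ g x) :
    pd i (fun y => Real.exp (g y)) x = Real.exp (g x) * pd i g x := by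
  rw [pd_eq_of_hasFDerivAt i h.hasFDerivAt.exp]
  simp [pd]

theorem pd_mul_const {g : Pt → ℝ} {x : Pt} (i : Fin 4) (c : ℝ) (h : DifferentiableAt ℝ g x) :
    pd i (fun y => g y * c) x = pd i g x * c := by
  rw [pd_eq_of_hasFDerivAt i (h.hasFDerivAt.mul_const c)]
  simp [pd, mul_comm]

theorem pd_mul {g k : Pt → ℝ} {x : Pt} (i : Fin 4) (hg : DifferentiableAt ℝ g x)
    (hk : DifferentiableAt ℝ k x) :
    pd i (fun y => g y * k y) x = g x * pd i k x + k x * pd i g x := by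
  rw [pd_eq_of_hasFDerivAt i (hg.hasFDerivAt.fun_mul hk.hasFDerivAt)]
  simp [pd]

theorem pd_add {g k : Pt → ℝ} {x : Pt} (i : Fin 4) (hg : DifferentiableAt ℝ g x)
    (hk : DifferentiableAt ℝ k x) :
    pd i (fun y => g y + k y) x = pd i g x + pd i k x := by
  rw [pd_eq_of_hasFDerivAt i (hg.hasFDerivAt.fun_add hk.hasFDerivAt)]
  simp [pd]

theorem pd_const (i : Fin 4) (c : ℝ) (x : Pt) : pd i (fun _ => c) x = 0 := by
  simp [pd]

theorem pd_coord (i j : Fin 4) (x : Pt) :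
    pd i (fun y => y j) x = if j = i then 1 else 0 := by
  rw [pd_eq_of_hasFDerivAt i (hasFDerivAt_apply j x)]
  simp [Pi.single_apply]

theorem pd_neg (i : Fin 4) (g : Pt → ℝ) (x : Pt) :
    pd i (fun y => - g y) x = - pd i g x := by
  simp [pd, fderiv_fun_neg]

theorem pd_E (i : Fin 4) (x : Pt) :
    pd i (fun y : Pt => (1 + y 0) * y 2) x =
      (1 + x 0) * (if 2 = i then 1 else 0) + x 2 * (if 0 = i then 1 else 0) := by
  have h0 : DifferentiableAt ℝ (fun y : Pt => y 0) x := by fun_prop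
  have h2 : DifferentiableAt ℝ (fun y : Pt => y 2) x := by fun_prop
  have h1 : DifferentiableAt ℝ (fun y : Pt => 1 + y 0) x := by fun_prop
  rw [pd_mul i h1 h2, pd_add i (by fun_prop) h0, pd_const, pd_coord, pd_coord]
  ring

theorem two_le_smooth' : (2 : WithTop ℕ∞) ≤ ((⊤ : ℕ∞) : WithTop ℕ∞) := by
  have h : ((2 : ℕ∞) : WithTop ℕ∞) ≤ ((⊤ : ℕ∞) : WithTop ℕ∞) := WithTop.coe_le_coe.2 le_top
  exact h

theorem two_le_smooth : (1 + 1 : WithTop ℕ∞) ≤ ((⊤ : ℕ∞) : WithTop ℕ∞) := by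
  rw [one_add_one_eq_two]
  exact two_le_smooth'

theorem pd_comm {f : Pt → ℝ} (hf : ContDiff ℝ (⊤ : ℕ∞) f) (i j : Fin 4) (x : Pt) :
    pd i (fun y => pd j f y) x = pd j (fun y => pd i f y) x := by
  have hd : Differentiable ℝ (fderiv ℝ f) :=
    (hf.fderiv_right (m := 1) two_le_smooth).differentiable (by norm_num)
  have key : ∀ a b : Fin 4, pd a (fun y => pd b f y) x =
      fderiv ℝ (fderiv ℝ f) x (Pi.single a 1) (Pi.single b 1) := by
    intro a b
    have h := (hd x).hasFDerivAt.clm_apply (hasFDerivAt_const (Pi.single b (1:ℝ) : Pt) x)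
    have h2 := pd_eq_of_hasFDerivAt a h
    simpa [pd] using h2
  rw [key, key]
  have hs : IsSymmSndFDerivAt ℝ f x :=
    hf.contDiffAt.isSymmSndFDerivAt 
      (by simpa [minSmoothness_of_isRCLikeNormedField] using two_le_smooth')
  exact hs.eq _ _

theorem pd_diff {f : Pt → ℝ} (hf : ContDiff ℝ (⊤ : ℕ∞) f) (i : Fin 4) :
    Differentiable ℝ (fun y => pd i f y) := by
  have hd : Differentiable ℝ (fderiv ℝ f) :=
    (hf.fderiv_right (m := 1) two_le_smooth).differentiable (by norm_num)
  unfold pd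
  fun_prop

/-- If a 2-form of type 3 is given in the normal form
`Ω = exp(f)·( exp((1+x¹)x³) dx¹∧dx² + dx³∧dx⁴ )`, `f(0) = 0`, and `F = exp(−f)`, then
`ω_Ω = df + (1+x¹)dx³` and `φ_Ω = −F_{x⁴} dx¹ + exp(−(1+x¹)x³)·F_{x²} dx³`. -/
theorem type3_omega_varphi (f : Pt → ℝ) (hf : ContDiff ℝ (⊤ : ℕ∞) f) (hf0 : f 0 = 0)
    (F : Pt → ℝ) (hF : ∀ x, F x = Real.exp (-(f x)))
    (Ω : Form2)
    (hΩ : ∀ x i j, Ω x i j =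
      Real.exp (f x) * (Real.exp ((1 + x 0) * x 2) * dxw 0 1 i j + dxw 2 3 i j))
    (ω : Form1) (hω : ∀ x, w12 ω Ω x = d2 Ω x)
    (θ : Form1) (hθ : ∀ x, w12 θ Ω x = w12 ω (d1 ω) x)
    (htype : IsTypeAt ω 3 0) :
    (∀ x i, ω x i = pd i f x + (1 + x 0) * (if i = (2 : Fin 4) then 1 else 0)) ∧
    (∀ x i, θ x i =
      -(pd 3 F x) * (if i = (0 : Fin 4) then 1 else 0)
        + Real.exp (-((1 + x 0) * x 2)) * pd 1 F x *
            (if i = (2 : Fin 4) then 1 else 0)) := by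
  have hfd : Differentiable ℝ f := hf.differentiable (by simp)
  have hEd : Differentiable ℝ (fun y : Pt => (1 + y 0) * y 2) := by fun_prop
  have hΩd : ∀ x i j k, pd i (fun y => Ω y j k) x =
      Real.exp (f x) * pd i f x * (Real.exp ((1 + x 0) * x 2) * dxw 0 1 j k + dxw 2 3 j k)
      + Real.exp (f x) * (Real.exp ((1 + x 0) * x 2) *
        ((1 + x 0) * (if 2 = i then 1 else 0) + x 2 * (if 0 = i then 1 else 0)) * dxw 0 1 j k) := by
    intro x i j k
    have e : (fun y => Ω y j k) = fun y =>
      Real.exp (f y) * (Real.exp ((1 + y 0) * y 2) * dxw 0 1 j k + dxw 2 3 j k) := by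
      funext y; exact hΩ y j k
    have h1 : DifferentiableAt ℝ (fun y => Real.exp (f y)) x := (hfd x).exp
    have h2 : DifferentiableAt ℝ (fun y : Pt => Real.exp ((1 + y 0) * y 2)) x := (hEd x).exp
    have h3 : DifferentiableAt ℝ (fun y : Pt => Real.exp ((1 + y 0) * y 2) * dxw 0 1 j k) x :=
      h2.mul_const _
    rw [e, pd_mul i h1 (h3.add_const _), pd_exp i (hfd x), pd_add i h3 (by fun_prop), pd_const,
      pd_mul_const i _ h2, pd_exp i (hEd x), pd_E]
    ring
  have hω' : ∀ x i, ω x i = pd i f x + (1 + x 0) * (if i = (2 : Fin 4) then 1 else 0) := by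
    intro x i
    have hA : Real.exp (f x) ≠ 0 := (Real.exp_pos _).ne'
    have hB : Real.exp ((1 + x 0) * x 2) ≠ 0 := (Real.exp_pos _).ne'
    have h := hω x
    have c012 := congrFun (congrFun (congrFun h 0) 1) 2
    have c013 := congrFun (congrFun (congrFun h 0) 1) 3
    have c023 := congrFun (congrFun (congrFun h 0) 2) 3
    have c123 := congrFun (congrFun (congrFun h 1) 2) 3
    simp only [w12, d2, hΩd] at c012 c013 c023 c123
    simp only [hΩ] at c012 c013 c023 c123
    simp [dxw] at c012 c013 c023 c123
    fin_cases i <;> simp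
    · apply mul_right_cancel₀ hA; linarith
    · apply mul_right_cancel₀ hA; linarith
    · apply mul_right_cancel₀ (mul_ne_zero hA hB); linarith
    · apply mul_right_cancel₀ (mul_ne_zero hA hB); linarith
  refine ⟨hω', ?_⟩
  have hωd : ∀ x i j, pd i (fun y => ω y j) x = pd i (fun y => pd j f y) x +
      (if 0 = i then 1 else 0) * (if j = (2 : Fin 4) then 1 else 0) := by
    intro x i j
    have e : (fun y => ω y j) = fun y => pd j f y +
        (1 + y 0) * (if j = (2 : Fin 4) then 1 else 0) := by
      funext y; exact hω' y j
    have h1 : DifferentiableAt ℝ (fun y : Pt => 1 + y 0) x := by fun_prop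
    rw [e, pd_add i (pd_diff hf j x) (h1.mul_const _), pd_mul_const i _ h1,
      pd_add i (by fun_prop) (by fun_prop), pd_const, pd_coord]
    ring
  have hd1 : ∀ x i j, d1 ω x i j = (if 0 = i then 1 else 0) * (if j = (2 : Fin 4) then 1 else 0)
      - (if 0 = j then 1 else 0) * (if i = (2 : Fin 4) then 1 else 0) := by
    intro x i j
    simp only [d1, hωd]
    rw [pd_comm hf i j x]
    ring
  have hFd : ∀ x i, pd i F x = - (Real.exp (-(f x)) * pd i f x) := by
    intro x i
    have e : F = fun y => Real.exp (-(f y)) := funext hF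
    rw [e, pd_exp i (hfd x).fun_neg, pd_neg]
    ring
  intro x i
  have hA : Real.exp (f x) ≠ 0 := (Real.exp_pos _).ne'
  have hB : Real.exp ((1 + x 0) * x 2) ≠ 0 := (Real.exp_pos _).ne'
  have h := hθ x
  have c012 := congrFun (congrFun (congrFun h 0) 1) 2
  have c013 := congrFun (congrFun (congrFun h 0) 1) 3
  have c023 := congrFun (congrFun (congrFun h 0) 2) 3
  have c123 := congrFun (congrFun (congrFun h 1) 2) 3
  simp only [w12, hd1, hω', hΩ] at c012 c013 c023 c123
  simp only [hFd, Real.exp_neg]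
  generalize Real.exp (f x) = A at *
  generalize Real.exp ((1 + x 0) * x 2) = B at *
  simp [dxw] at c012 c013 c023 c123
  fin_cases i <;> simp
  · field_simp; linarith
  · tauto
  · field_simp; linarith
  · tauto
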